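/- For two jointly distributed random variables (X_1, X_2) taking values in finite sets, the maximal correlation ribbon is 𝔖(X_1, X_2) = { (λ_1, λ_2) ∈ [0,1]^2 : (1 − 1/λ_1)(1 − 1/λ_2) ≥ ρ(X_1, X_2)² } (with the convention that the condition is interpreted so that pairs with λ_1 = 0 or λ_2 = 0 always belong to the ribbon), where ρ(X_1, X_2) is the maximal correlation. -/

import Mathlib

open Finset

noncomputable section

/-- A probability mass function on a finite type. -/
def IsPMF {Ω : Type*} [Fintype Ω] (p : Ω → ℝ) : Prop :=
  (∀ ω, 0 ≤ p ω) ∧ ∑ ω, p ω = 1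

/-- Expectation of `f` under the pmf `p`. -/
def expect {Ω : Type*} [Fintype Ω] (p : Ω → ℝ) (f : Ω → ℝ) : ℝ :=
  ∑ ω, p ω * f ω

/-- Variance of `f` under the pmf `p`. -/
def var {Ω : Type*} [Fintype Ω] (p : Ω → ℝ) (f : Ω → ℝ) : ℝ :=
  ∑ ω, p ω * (f ω - expect p f) ^ 2

open scoped Classical in
/-- Conditional expectation `E[f | X]`, as a function on the sample space. -/
def condExp {Ω β : Type*} [Fintype Ω] (p : Ω → ℝ) (f : Ω → ℝ) (X : Ω → β) : Ω → ℝ :=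
  fun ω => (∑ ω', if X ω' = X ω then p ω' * f ω' else 0) /
    (∑ ω', if X ω' = X ω then p ω' else 0)

/-- The Φ-entropy `H_Φ(f) = E[Φ(f)] - Φ(E[f])`. -/
def Hphi {Ω : Type*} [Fintype Ω] (Φ : ℝ → ℝ) (p : Ω → ℝ) (f : Ω → ℝ) : ℝ :=
  expect p (fun ω => Φ (f ω)) - Φ (expect p f)

/-- The conditional Φ-entropy `H_Φ(f | X) = E[Φ(f)] - E[Φ(E[f|X])]`. -/
def HphiCond {Ω β : Type*} [Fintype Ω] (Φ : ℝ → ℝ) (p : Ω → ℝ) (f : Ω → ℝ) (X : Ω → β) : ℝ :=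
  expect p (fun ω => Φ (f ω)) - expect p (fun ω => Φ (condExp p f X ω))

/-- The class 𝓕 of smooth convex non-affine functions `Φ` on a convex domain `D ⊆ ℝ`
such that for every `q ∈ [0,1]` the map
`(s,t) ↦ q Φ(s) + (1-q) Φ(t) - Φ(q s + (1-q) t)` is jointly convex. -/
structure ClassF where
  D : Set ℝ
  Φ : ℝ → ℝ
  convex_dom : Convex ℝ D
  smooth : ContDiffOn ℝ (⊤ : ℕ∞) Φ D
  convexOn : ConvexOn ℝ D Φ
  not_affine : ¬ ∃ a b : ℝ, ∀ t ∈ D, Φ t = a * t + b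
  joint_convex : ∀ q ∈ Set.Icc (0:ℝ) 1,
    ConvexOn ℝ (D ×ˢ D)
      (fun st : ℝ × ℝ => q * Φ st.1 + (1 - q) * Φ st.2 - Φ (q * st.1 + (1 - q) * st.2))

/-- The maximal correlation `ρ(X, Y)` of a joint pmf `p` on `α × β`: the supremum of the
Pearson correlation of `f(X)` and `g(Y)` over all non-constant (non-degenerate) `f`, `g`. -/
def maxCorr {α β : Type} [Fintype α] [Fintype β] (p : α × β → ℝ) : ℝ :=
  sSup {r : ℝ | ∃ f : α → ℝ, ∃ g : β → ℝ,
    var p (fun ω => f ω.1) ≠ 0 ∧ var p (fun ω => g ω.2) ≠ 0 ∧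
    r = expect p (fun ω => (f ω.1 - expect p (fun ω' => f ω'.1)) *
          (g ω.2 - expect p (fun ω' => g ω'.2))) /
        Real.sqrt (var p (fun ω => f ω.1) * var p (fun ω => g ω.2))}
/-- The bipartite maximal correlation ribbon `𝔖(X_1, X_2)` of a joint pmf `p` on `α × β`. -/
def mcRibbon2 {α β : Type} [Fintype α] [Fintype β] (p : α × β → ℝ) : Set (ℝ × ℝ) :=
  {l | l.1 ∈ Set.Icc (0:ℝ) 1 ∧ l.2 ∈ Set.Icc (0:ℝ) 1 ∧ ∀ f : α × β → ℝ,
    var p f ≥ l.1 * var p (condExp p f Prod.fst) + l.2 * var p (condExp p f Prod.snd)}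

theorem expect_linear_comb {Ω : Type*} [Fintype Ω] (p f g : Ω → ℝ) (a b : ℝ) :
    expect p (fun ω => a * f ω + b * g ω) = a * expect p f + b * expect p g := by
  simp only [_root_.expect, Finset.mul_sum, ← Finset.sum_add_distrib]
  exact Finset.sum_congr rfl fun _ _ => by ring

theorem expect_sub_const {Ω : Type*} [Fintype Ω] {p : Ω → ℝ} (hp : IsPMF p) (f : Ω → ℝ) (c : ℝ) :
    expect p (fun ω => f ω - c) = expect p f - c := by
  simp [_root_.expect, mul_sub, Finset.sum_sub_distrib, ← Finset.sum_mul, hp.2]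

theorem var_nonneg {Ω : Type*} [Fintype Ω] {p : Ω → ℝ} (hp : IsPMF p) (f : Ω → ℝ) :
    0 ≤ var p f :=
  Finset.sum_nonneg fun ω _ => mul_nonneg (hp.1 ω) (sq_nonneg _)

theorem var_eq_expect {Ω : Type*} [Fintype Ω] (p f : Ω → ℝ) :
    var p f = expect p (fun ω => (f ω - expect p f) ^ 2) :=
  rfl

theorem var_eq_expect_sq {Ω : Type*} [Fintype Ω] {p f : Ω → ℝ} (hf : expect p f = 0) :
    var p f = expect p (fun ω => f ω ^ 2) := by
  simp [var_eq_expect, hf]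

/-- The Cauchy–Schwarz inequality for expectations. -/
theorem expect_mul_sq_le {Ω : Type*} [Fintype Ω] {p : Ω → ℝ} (hp : IsPMF p) (f g : Ω → ℝ) :
    expect p (fun ω => f ω * g ω) ^ 2 ≤
      expect p (fun ω => f ω ^ 2) * expect p (fun ω => g ω ^ 2) :=
  Finset.sum_sq_le_sum_mul_sum_of_sq_le_mul _
    (fun ω _ => mul_nonneg (hp.1 ω) (sq_nonneg _))
    (fun ω _ => mul_nonneg (hp.1 ω) (sq_nonneg _)) (fun ω _ => le_of_eq (by ring))

/-- The defining property of conditional expectation. -/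
theorem expect_condExp_mul {Ω β : Type*} [Fintype Ω] {p : Ω → ℝ} (hp : IsPMF p) (f : Ω → ℝ)
    (X : Ω → β) (h : β → ℝ) :
    expect p (fun ω => condExp p f X ω * h (X ω)) = expect p (fun ω => f ω * h (X ω)) := by
  classical
  set P : β → ℝ := fun x => ∑ ω', if X ω' = x then p ω' else 0 with hP
  have hP0 : ∀ ω, P (X ω) = 0 → p ω = 0 := fun ω hω => by
    have := (Finset.sum_eq_zero_iff_of_nonneg
      (fun ω' _ => by split_ifs <;> simp [hp.1])).1 hω ω (Finset.mem_univ _)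
    simpa using this
  have hl : expect p (fun ω => condExp p f X ω * h (X ω)) =
      ∑ ω, ∑ ω', if X ω' = X ω then p ω * (p ω' * f ω' * (h (X ω') / P (X ω'))) else 0 := by
    refine Finset.sum_congr rfl fun ω _ => ?_
    have hc : condExp p f X ω = (∑ ω', if X ω' = X ω then p ω' * f ω' else 0) / P (X ω) := by
      simp only [condExp, hP]
    simp only [hc]
    rw [div_mul_eq_mul_div, mul_div_assoc, Finset.sum_mul, Finset.mul_sum]
    refine Finset.sum_congr rfl fun ω' _ => ?_
    split_ifs with hx
    · rw [hx]
    · simp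
  rw [hl, Finset.sum_comm]
  refine Finset.sum_congr rfl fun ω _ => ?_
  have : (∑ ω', if X ω = X ω' then p ω' * (p ω * f ω * (h (X ω) / P (X ω))) else 0) =
      P (X ω) * (p ω * f ω * (h (X ω) / P (X ω))) := by
    rw [hP, Finset.sum_mul]
    refine Finset.sum_congr rfl fun ω' _ => ?_
    simp only [eq_comm (a := X ω)]
    split_ifs <;> simp
  rw [this]
  by_cases h0 : P (X ω) = 0
  · simp [hP0 ω h0]
  · field_simp

theorem expect_condExp {Ω β : Type*} [Fintype Ω] {p : Ω → ℝ} (hp : IsPMF p) (f : Ω → ℝ)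
    (X : Ω → β) : expect p (condExp p f X) = expect p f := by
  simpa using expect_condExp_mul hp f X (fun _ => 1)

theorem sq_expect_mul_le_var_condExp {Ω β : Type*} [Fintype Ω] {p : Ω → ℝ} (hp : IsPMF p)
    (f : Ω → ℝ) (X : Ω → β) {h : β → ℝ} (hh : expect p (fun ω => h (X ω)) = 0) :
    expect p (fun ω => f ω * h (X ω)) ^ 2 ≤
      var p (condExp p f X) * expect p (fun ω => h (X ω) ^ 2) := by
  have hc := expect_linear_comb p (fun ω => condExp p f X ω * h (X ω)) (fun ω => h (X ω)) 1
    (-expect p (condExp p f X))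
  have := expect_mul_sq_le hp (fun ω => condExp p f X ω - expect p (condExp p f X))
    (fun ω => h (X ω))
  rw [hh, expect_condExp_mul hp] at hc
  rw [show expect p (fun ω => f ω * h (X ω)) =
    expect p (fun ω => (condExp p f X ω - expect p (condExp p f X)) * h (X ω)) by
      rw [mul_zero, add_zero, one_mul] at hc
      rw [← hc]
      congr 1
      ext ω
      ring]
  exact this

theorem exists_condExp_eq_comp {Ω β : Type*} [Fintype Ω] (p f : Ω → ℝ) (X : Ω → β) :
    ∃ h : β → ℝ, condExp p f X = fun ω => h (X ω) := by
  classical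
  exact ⟨fun x => (∑ ω', if X ω' = x then p ω' * f ω' else 0) /
    (∑ ω', if X ω' = x then p ω' else 0), by ext ω; simp only [condExp]⟩

theorem expect_sub_mul_condExp_sub {Ω β : Type*} [Fintype Ω] {p : Ω → ℝ} (hp : IsPMF p)
    (f : Ω → ℝ) (X : Ω → β) :
    expect p (fun ω => (f ω - expect p f) * (condExp p f X ω - expect p f)) =
      var p (condExp p f X) := by
  obtain ⟨h, hh⟩ := exists_condExp_eq_comp p f X
  have h1 := expect_condExp_mul hp f X (fun x => h x - expect p f)
  have h2 := expect_condExp hp f X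
  have h4 := expect_linear_comb p (fun ω => f ω * (h (X ω) - expect p f))
    (fun ω => h (X ω) - expect p f) 1 (-expect p f)
  have h5 := expect_linear_comb p (fun ω => condExp p f X ω * (h (X ω) - expect p f))
    (fun ω => h (X ω) - expect p f) 1 (-expect p f)
  have h6 : var p (condExp p f X) = expect p (fun ω => (condExp p f X ω - expect p f) ^ 2) := by
    rw [var_eq_expect, h2]
  rw [h1, ← h4] at h5
  rw [h6]
  have hx : ∀ ω, h (X ω) = condExp p f X ω := fun ω => by rw [hh]
  simp only [hx] at h5
  refine Eq.trans ?_ (h5.symm.trans ?_) <;> congr 1 <;> ext ω <;> ring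

theorem cov_sq_le_var_mul_var {Ω : Type*} [Fintype Ω] {p : Ω → ℝ} (hp : IsPMF p) (f g : Ω → ℝ) :
    expect p (fun ω => (f ω - expect p f) * (g ω - expect p g)) ^ 2 ≤ var p f * var p g :=
  expect_mul_sq_le hp (fun ω => f ω - expect p f) (fun ω => g ω - expect p g)

theorem cov_le_maxCorr_mul {α β : Type} [Fintype α] [Fintype β] {p : α × β → ℝ} (hp : IsPMF p)
    (f : α → ℝ) (g : β → ℝ) (hf : var p (fun ω => f ω.1) ≠ 0)
    (hg : var p (fun ω => g ω.2) ≠ 0) :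
    expect p (fun ω => (f ω.1 - expect p (fun ω' => f ω'.1)) *
      (g ω.2 - expect p (fun ω' => g ω'.2))) ≤
    maxCorr p * √(var p (fun ω => f ω.1) * var p (fun ω => g ω.2)) := by
  have hpos : 0 < var p (fun ω => f ω.1) * var p (fun ω => g ω.2) :=
    mul_pos ((var_nonneg hp _).lt_of_ne' hf) ((var_nonneg hp _).lt_of_ne' hg)
  rw [← div_le_iff₀ (Real.sqrt_pos.2 hpos)]
  refine le_csSup ⟨1, ?_⟩ ⟨f, g, hf, hg, rfl⟩
  rintro r ⟨f', g', -, -, rfl⟩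
  refine div_le_one_of_le₀ (Real.le_sqrt_of_sq_le ?_) (Real.sqrt_nonneg _)
  exact cov_sq_le_var_mul_var hp (fun ω => f' ω.1) (fun ω => g' ω.2)

theorem abs_cov_le_maxCorr_mul {α β : Type} [Fintype α] [Fintype β] {p : α × β → ℝ}
    (hp : IsPMF p) (f : α → ℝ) (g : β → ℝ) (hf : var p (fun ω => f ω.1) ≠ 0)
    (hg : var p (fun ω => g ω.2) ≠ 0) :
    |expect p (fun ω => (f ω.1 - expect p (fun ω' => f ω'.1)) *
      (g ω.2 - expect p (fun ω' => g ω'.2)))| ≤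
    maxCorr p * √(var p (fun ω => f ω.1) * var p (fun ω => g ω.2)) := by
  have hneg : ∀ h : α × β → ℝ, expect p (fun ω => -h ω) = -expect p h := fun h => by
    simp [_root_.expect]
  have hvar : var p (fun ω => -f ω.1) = var p (fun ω => f ω.1) := by
    simp only [var, hneg]
    exact Finset.sum_congr rfl fun _ _ => by ring
  have h1 := cov_le_maxCorr_mul hp f g hf hg
  have h2 := cov_le_maxCorr_mul hp (fun a => -f a) g (by rwa [hvar]) hg
  have hcov : expect p (fun ω => (-f ω.1 - -expect p (fun ω' => f ω'.1)) *
      (g ω.2 - expect p (fun ω' => g ω'.2))) =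
      -expect p (fun ω => (f ω.1 - expect p (fun ω' => f ω'.1)) *
      (g ω.2 - expect p (fun ω' => g ω'.2))) := by
    refine Eq.trans ?_ (hneg _)
    congr 1
    ext ω
    ring
  rw [hvar, hneg, hcov] at h2
  exact abs_le.2 ⟨by linarith, h1⟩

theorem cov_sq_le_maxCorr_sq_mul {α β : Type} [Fintype α] [Fintype β] {p : α × β → ℝ}
    (hp : IsPMF p) (f : α → ℝ) (g : β → ℝ) :
    expect p (fun ω => (f ω.1 - expect p (fun ω' => f ω'.1)) *
      (g ω.2 - expect p (fun ω' => g ω'.2))) ^ 2 ≤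
    maxCorr p ^ 2 * (var p (fun ω => f ω.1) * var p (fun ω => g ω.2)) := by
  by_cases hf : var p (fun ω => f ω.1) = 0
  · simpa [hf] using cov_sq_le_var_mul_var hp (fun ω => f ω.1) (fun ω => g ω.2)
  by_cases hg : var p (fun ω => g ω.2) = 0
  · simpa [hg] using cov_sq_le_var_mul_var hp (fun ω => f ω.1) (fun ω => g ω.2)
  have := abs_le.1 (abs_cov_le_maxCorr_mul hp f g hf hg)
  rw [← Real.sq_sqrt (mul_nonneg (var_nonneg hp (fun ω => f ω.1))
    (var_nonneg hp (fun ω => g ω.2))), ← mul_pow]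
  exact sq_le_sq' this.1 this.2

theorem sq_mul_le_of_quadratic_bound {A B C l m : ℝ} (hA : 0 < A) (hB : 0 < B)
    (hC : C ^ 2 ≤ A * B) (h : ∀ a b : ℝ,
      l * ((a * A + b * C) ^ 2 / A) + m * ((a * C + b * B) ^ 2 / B) ≤
        a ^ 2 * A + 2 * a * b * C + b ^ 2 * B) :
    l * m * C ^ 2 ≤ (1 - l) * (1 - m) * (A * B) := by
  have hAB := mul_pos hA hB
  rcases hC.lt_or_eq with hlt | heq
  · have hd := discrim_le_zero (a := A * (1 - l) - m * C ^ 2 / B) (b := 2 * C * (1 - l - m))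
      (c := B * (1 - m) - l * C ^ 2 / A) fun x => by
        have := h x 1
        have e : (A * (1 - l) - m * C ^ 2 / B) * (x * x) + 2 * C * (1 - l - m) * x +
          (B * (1 - m) - l * C ^ 2 / A) = x ^ 2 * A + 2 * x * 1 * C + 1 ^ 2 * B -
          (l * ((x * A + 1 * C) ^ 2 / A) + m * ((x * C + 1 * B) ^ 2 / B)) := by
          field_simp
          ring
        linarith
    have e : discrim (A * (1 - l) - m * C ^ 2 / B) (2 * C * (1 - l - m))
        (B * (1 - m) - l * C ^ 2 / A) =
        -(4 * (A * B - C ^ 2) / (A * B)) * ((1 - l) * (1 - m) * (A * B) - l * m * C ^ 2) := by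
      rw [discrim]
      field_simp
      ring
    rw [e] at hd
    have hk : 0 < 4 * (A * B - C ^ 2) / (A * B) := by
      have := sub_pos.2 hlt
      positivity
    by_contra! hcon
    nlinarith
  · have h1 := h B C
    have e : l * ((B * A + C * C) ^ 2 / A) + m * ((B * C + C * B) ^ 2 / B) =
        (l + m) * (4 * (A * B) * B) := by
      rw [show B * A + C * C = 2 * (A * B) by linarith,
        show (B * C + C * B) ^ 2 = 4 * B ^ 2 * (A * B) by rw [← heq]; ring]
      field_simp
      ring
    rw [e, show B ^ 2 * A + 2 * B * C * C + C ^ 2 * B = 4 * (A * B) * B by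
      rw [show 2 * B * C * C = 2 * B * C ^ 2 by ring, heq]; ring] at h1
    have hlm : l + m ≤ 1 := by
      have : 0 < 4 * (A * B) * B := by positivity
      nlinarith
    rw [heq]
    nlinarith

theorem cov_sq_le_of_mem_mcRibbon2 {α β : Type} [Fintype α] [Fintype β] {p : α × β → ℝ}
    (hp : IsPMF p) {l : ℝ × ℝ} (hl : l ∈ mcRibbon2 p) {f : α → ℝ} {g : β → ℝ}
    (hf : var p (fun ω => f ω.1) ≠ 0) (hg : var p (fun ω => g ω.2) ≠ 0) :
    l.1 * l.2 * expect p (fun ω => (f ω.1 - expect p (fun ω' => f ω'.1)) *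
      (g ω.2 - expect p (fun ω' => g ω'.2))) ^ 2 ≤
    (1 - l.1) * (1 - l.2) * (var p (fun ω => f ω.1) * var p (fun ω => g ω.2)) := by
  obtain ⟨⟨hl1, -⟩, ⟨hl2, -⟩, hl⟩ := hl
  have hA := (var_nonneg hp _).lt_of_ne' hf
  have hB := (var_nonneg hp _).lt_of_ne' hg
  refine sq_mul_le_of_quadratic_bound hA hB
    (cov_sq_le_var_mul_var hp (fun ω => f ω.1) (fun ω => g ω.2)) fun a b => ?_
  set f' : α → ℝ := fun x => f x - expect p (fun ω' => f ω'.1) with hf'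
  set g' : β → ℝ := fun y => g y - expect p (fun ω' => g ω'.2) with hg'
  have hf0 : expect p (fun ω => f' ω.1) = 0 := by simp [hf', expect_sub_const hp]
  have hg0 : expect p (fun ω => g' ω.2) = 0 := by simp [hg', expect_sub_const hp]
  have hAe : var p (fun ω => f ω.1) = expect p (fun ω => f' ω.1 ^ 2) := rfl
  have hBe : var p (fun ω => g ω.2) = expect p (fun ω => g' ω.2 ^ 2) := rfl
  set A := var p (fun ω => f ω.1)
  set B := var p (fun ω => g ω.2)
  change l.1 * ((a * A + b * expect p (fun ω => f' ω.1 * g' ω.2)) ^ 2 / A) +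
    l.2 * ((a * expect p (fun ω => f' ω.1 * g' ω.2) + b * B) ^ 2 / B) ≤
    a ^ 2 * A + 2 * a * b * expect p (fun ω => f' ω.1 * g' ω.2) + b ^ 2 * B
  set C := expect p (fun ω => f' ω.1 * g' ω.2) with hC
  set F : α × β → ℝ := fun ω => a * f' ω.1 + b * g' ω.2 with hF
  have hF0 : expect p F = 0 := by rw [hF, expect_linear_comb, hf0, hg0]; ring
  have hF1 : expect p (fun ω => F ω * f' ω.1) = a * A + b * C := by
    rw [hAe, hC, ← expect_linear_comb]
    congr 1
    ext ω
    simp only [hF]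
    ring
  have hF2 : expect p (fun ω => F ω * g' ω.2) = a * C + b * B := by
    rw [hBe, hC, ← expect_linear_comb]
    congr 1
    ext ω
    simp only [hF]
    ring
  have hFv : var p F = a ^ 2 * A + 2 * a * b * C + b ^ 2 * B := by
    rw [var_eq_expect_sq hF0, show a ^ 2 * A + 2 * a * b * C + b ^ 2 * B =
      a * (a * A + b * C) + b * (a * C + b * B) by ring, ← hF1, ← hF2, ← expect_linear_comb]
    congr 1
    ext ω
    simp only [hF]
    ring
  have h1 := sq_expect_mul_le_var_condExp hp F Prod.fst hf0
  have h2 := sq_expect_mul_le_var_condExp hp F Prod.snd hg0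
  rw [hF1, ← hAe, ← div_le_iff₀ hA] at h1
  rw [hF2, ← hBe, ← div_le_iff₀ hB] at h2
  rw [← hFv]
  exact (add_le_add (mul_le_mul_of_nonneg_left h1 hl1)
    (mul_le_mul_of_nonneg_left h2 hl2)).trans (hl F)

theorem var_ge_of_maxCorr_sq_le {α β : Type} [Fintype α] [Fintype β] {p : α × β → ℝ}
    (hp : IsPMF p) {l m : ℝ} (hl : l ∈ Set.Icc (0 : ℝ) 1) (hm : m ∈ Set.Icc (0 : ℝ) 1)
    (h : l * m * maxCorr p ^ 2 ≤ (1 - l) * (1 - m)) (f : α × β → ℝ) :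
    l * var p (condExp p f Prod.fst) + m * var p (condExp p f Prod.snd) ≤ var p f := by
  obtain ⟨u, hu⟩ := exists_condExp_eq_comp p f Prod.fst
  obtain ⟨v, hv⟩ := exists_condExp_eq_comp p f Prod.snd
  have hcov := cov_sq_le_maxCorr_sq_mul hp u v
  have hfu := expect_sub_mul_condExp_sub hp f Prod.fst
  have hfv := expect_sub_mul_condExp_sub hp f Prod.snd
  have hEu := expect_condExp hp f Prod.fst
  have hEv := expect_condExp hp f Prod.snd
  have hU := var_nonneg hp (condExp p f Prod.fst)
  have hV := var_nonneg hp (condExp p f Prod.snd)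
  have hUe : var p (condExp p f Prod.fst) = expect p (fun ω => (u ω.1 - expect p f) ^ 2) := by
    rw [var_eq_expect, hEu, hu]
  have hVe : var p (condExp p f Prod.snd) = expect p (fun ω => (v ω.2 - expect p f) ^ 2) := by
    rw [var_eq_expect, hEv, hv]
  rw [← hu, ← hv, hEu, hEv] at hcov
  set U := var p (condExp p f Prod.fst)
  set V := var p (condExp p f Prod.snd)
  set c := expect p (fun ω => (u ω.1 - expect p f) * (v ω.2 - expect p f)) with hc
  simp only [hu] at hfu
  simp only [hv] at hfv
  have hsq : 0 ≤ expect p (fun ω => (f ω - expect p f - l * (u ω.1 - expect p f) -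
      m * (v ω.2 - expect p f)) ^ 2) :=
    Finset.sum_nonneg fun ω _ => mul_nonneg (hp.1 ω) (sq_nonneg _)
  have hexp : expect p (fun ω => (f ω - expect p f - l * (u ω.1 - expect p f) -
      m * (v ω.2 - expect p f)) ^ 2) =
      var p f - 2 * l * U - 2 * m * V + l ^ 2 * U + m ^ 2 * V + 2 * l * m * c := by
    have e : var p f - 2 * l * U - 2 * m * V + l ^ 2 * U + m ^ 2 * V + 2 * l * m * c =
        var p f - 2 * l * expect p (fun ω => (f ω - expect p f) * (u ω.1 - expect p f))
        - 2 * m * expect p (fun ω => (f ω - expect p f) * (v ω.2 - expect p f))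
        + l ^ 2 * expect p (fun ω => (u ω.1 - expect p f) ^ 2)
        + m ^ 2 * expect p (fun ω => (v ω.2 - expect p f) ^ 2) + 2 * l * m * c := by
      rw [hfu, hfv, ← hUe, ← hVe]
    rw [e, hc, var]
    generalize expect p f = E
    simp only [_root_.expect, Finset.mul_sum, ← Finset.sum_add_distrib, ← Finset.sum_sub_distrib]
    exact Finset.sum_congr rfl fun _ _ => by ring
  rw [hexp] at hsq
  obtain ⟨hl0, hl1⟩ := hl
  obtain ⟨hm0, hm1⟩ := hm
  have hx : 0 ≤ l * (1 - l) * U := mul_nonneg (mul_nonneg hl0 (sub_nonneg.2 hl1)) hU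
  have hy : 0 ≤ m * (1 - m) * V := mul_nonneg (mul_nonneg hm0 (sub_nonneg.2 hm1)) hV
  have hz : (2 * (l * m * c)) ^ 2 ≤ (l * (1 - l) * U + m * (1 - m) * V) ^ 2 := by
    have h1 : (l * m) ^ 2 * c ^ 2 ≤ (l * m) ^ 2 * (maxCorr p ^ 2 * (U * V)) :=
      mul_le_mul_of_nonneg_left hcov (sq_nonneg _)
    have h2 := mul_le_mul_of_nonneg_right h
      (mul_nonneg (mul_nonneg hl0 hm0) (mul_nonneg hU hV))
    nlinarith [sq_nonneg (l * (1 - l) * U - m * (1 - m) * V)]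
  have := abs_le_of_sq_le_sq' hz (by positivity)
  nlinarith [this.1, this.2]

theorem maxCorr_sq_le {α β : Type} [Fintype α] [Fintype β] {p : α × β → ℝ} (hp : IsPMF p)
    {K : ℝ} (hK : 0 ≤ K) (h : ∀ (f : α → ℝ) (g : β → ℝ),
      var p (fun ω => f ω.1) ≠ 0 → var p (fun ω => g ω.2) ≠ 0 →
      expect p (fun ω => (f ω.1 - expect p (fun ω' => f ω'.1)) *
        (g ω.2 - expect p (fun ω' => g ω'.2))) ^ 2 ≤
      K * (var p (fun ω => f ω.1) * var p (fun ω => g ω.2))) :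
    maxCorr p ^ 2 ≤ K := by
  have hub : maxCorr p ≤ √K := by
    refine Real.sSup_le ?_ (Real.sqrt_nonneg _)
    rintro r ⟨f, g, hf, hg, rfl⟩
    have hpos : 0 < var p (fun ω => f ω.1) * var p (fun ω => g ω.2) :=
      mul_pos ((var_nonneg hp _).lt_of_ne' hf) ((var_nonneg hp _).lt_of_ne' hg)
    rw [div_le_iff₀ (Real.sqrt_pos.2 hpos), ← Real.sqrt_mul hK]
    exact Real.le_sqrt_of_sq_le (h f g hf hg)
  have hlb : 0 ≤ maxCorr p := by
    by_cases hne : ∃ (f : α → ℝ) (g : β → ℝ),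
        var p (fun ω => f ω.1) ≠ 0 ∧ var p (fun ω => g ω.2) ≠ 0
    · obtain ⟨f, g, hf, hg⟩ := hne
      have hpos : 0 < √(var p (fun ω => f ω.1) * var p (fun ω => g ω.2)) :=
        Real.sqrt_pos.2
          (mul_pos ((var_nonneg hp _).lt_of_ne' hf) ((var_nonneg hp _).lt_of_ne' hg))
      exact nonneg_of_mul_nonneg_left
        ((abs_nonneg _).trans (abs_cov_le_maxCorr_mul hp f g hf hg)) hpos
    · push Not at hne
      refine Real.sSup_nonneg ?_
      rintro r ⟨f, g, hf, hg, -⟩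
      exact absurd (hne f g hf) hg
  calc maxCorr p ^ 2 ≤ √K ^ 2 := pow_le_pow_left₀ hlb hub 2
    _ = K := Real.sq_sqrt hK

/-- Bipartite characterization of the MC ribbon:
`𝔖(X_1, X_2) = { (λ₁, λ₂) ∈ [0,1]² : (1 − 1/λ₁)(1 − 1/λ₂) ≥ ρ(X_1,X_2)² }`,
with the convention that pairs with `λ₁ = 0` or `λ₂ = 0` always belong to the ribbon. -/
theorem mcRibbon2_eq_maxCorr_region
    {α β : Type} [Fintype α] [Fintype β]
    (p : α × β → ℝ) (hp : IsPMF p) :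
    mcRibbon2 p = {l : ℝ × ℝ | l.1 ∈ Set.Icc (0:ℝ) 1 ∧ l.2 ∈ Set.Icc (0:ℝ) 1 ∧
      (l.1 = 0 ∨ l.2 = 0 ∨ (1 - 1 / l.1) * (1 - 1 / l.2) ≥ maxCorr p ^ 2)} := by
  ext l
  refine ⟨fun hl => ⟨hl.1, hl.2.1, ?_⟩, fun ⟨h1, h2, h⟩ =>
    ⟨h1, h2, var_ge_of_maxCorr_sq_le hp h1 h2 ?_⟩⟩
  · rcases hl.1.1.eq_or_lt with h1 | h1
    · exact Or.inl h1.symm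
    rcases hl.2.1.1.eq_or_lt with h2 | h2
    · exact Or.inr (Or.inl h2.symm)
    have hK : (1 - 1 / l.1) * (1 - 1 / l.2) = (1 - l.1) * (1 - l.2) / (l.1 * l.2) := by
      field_simp
      ring
    refine Or.inr (Or.inr ?_)
    rw [hK]
    refine maxCorr_sq_le hp (div_nonneg (mul_nonneg (sub_nonneg.2 hl.1.2)
      (sub_nonneg.2 hl.2.1.2)) (mul_pos h1 h2).le) fun f g hf hg => ?_
    rw [div_mul_eq_mul_div, le_div_iff₀ (mul_pos h1 h2), mul_comm]
    exact cov_sq_le_of_mem_mcRibbon2 hp hl hf hg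
  · rcases h1.1.eq_or_lt with h1' | h1'
    · simpa [← h1'] using h2.2
    rcases h2.1.eq_or_lt with h2' | h2'
    · simpa [← h2'] using h1.2
    replace h := (h.resolve_left h1'.ne').resolve_left h2'.ne'
    calc l.1 * l.2 * maxCorr p ^ 2 ≤ l.1 * l.2 * ((1 - 1 / l.1) * (1 - 1 / l.2)) :=
          mul_le_mul_of_nonneg_left h (mul_pos h1' h2').le
      _ = (1 - l.1) * (1 - l.2) := by
          field_simp
          ring

end
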